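/- arXiv:1104.2960 — 7 statements merged into one kernel-verified Lean document; each statement's English description precedes it below -/
import Mathlib

section
/- Let m ≥ 1 and let C_m be the long loop (cycle) quiver with vertex set {0, 1, ..., m−1} and arrows a_i from vertex i to vertex i+1 (indices mod m). For any group G, two G-valued representations f, f' : {a_0, ..., a_{m−1}} → G of C_m are gauge-equivalent if and only if the holonomy products f(a_{m−1})·f(a_{m−2})⋯f(a_0) and f'(a_{m−1})·f'(a_{m−2})⋯f'(a_0) are conjugate in G. Consequently the gauge-orbit space of G-valued representations of C_m is in bijection with the set of conjugacy classes G/G of the conjugation action of G on itself. -/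
/-- Gauge equivalence of `G`-valued representations of a quiver with arrow set `A`,
vertex set `V`, head map `hd` and tail map `tl`. -/
def gaugeRel {G V A : Type*} [Group G] (hd tl : A → V) (f f' : A → G) : Prop :=
  ∃ g : V → G, ∀ a, f' a = g (hd a) * f a * (g (tl a))⁻¹

/-- The setoid of gauge equivalence on `G`-valued representations of a quiver. -/
def gaugeSetoid (G : Type*) [Group G] {V A : Type*} (hd tl : A → V) : Setoid (A → G) where
  r := gaugeRel hd tl
  iseqv := by
    constructor
    · intro f
      exact ⟨fun _ => 1, fun a => by simp⟩
    · rintro f f' ⟨g, hg⟩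
      exact ⟨fun v => (g v)⁻¹, fun a => by rw [hg a]; group⟩
    · rintro f f' f'' ⟨g, hg⟩ ⟨g', hg'⟩
      exact ⟨fun v => g' v * g v, fun a => by rw [hg' a, hg a]; group⟩

/-- The ordered product `F (n - 1) * ⋯ * F 0`. -/
def descProd {G : Type*} [Group G] (F : ℕ → G) : ℕ → G
  | 0 => 1
  | n + 1 => F n * descProd F n

theorem prod_reverse_ofFn_eq_descProd {G : Type*} [Group G] (F : ℕ → G) (n : ℕ) :
    (List.ofFn fun i : Fin n => F i).reverse.prod = descProd F n := by
  induction n with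
  | zero => simp [descProd]
  | succ n ih => rw [List.ofFn_succ', descProd, ← ih]; simp

theorem prod_reverse_ofFn {G : Type*} [Group G] {m : ℕ} [NeZero m] (f : Fin m → G) :
    (List.ofFn f).reverse.prod = descProd (fun n => f (Fin.ofNat m n)) m := by
  rw [← prod_reverse_ofFn_eq_descProd]
  simp

theorem Fin.ofNat_add_one {m : ℕ} [NeZero m] (n : ℕ) :
    Fin.ofNat m (n + 1) = Fin.ofNat m n + 1 := by
  ext
  simp [Fin.val_add]

theorem descProd_gauge {G : Type*} [Group G] {F F' g : ℕ → G}
    (h : ∀ n, F' n = g (n + 1) * F n * (g n)⁻¹) (n : ℕ) :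
    descProd F' n = g n * descProd F n * (g 0)⁻¹ := by
  induction n with
  | zero => simp [descProd]
  | succ n ih => simp [descProd, ih, h, mul_assoc]

theorem gaugeRel_cycle_iff {G : Type*} [Group G] {m : ℕ} [NeZero m] (f f' : Fin m → G) :
    gaugeRel (fun i : Fin m => i + 1) (fun i => i) f f' ↔
      IsConj ((List.ofFn f).reverse.prod) ((List.ofFn f').reverse.prod) := by
  rw [prod_reverse_ofFn, prod_reverse_ofFn, isConj_iff]
  constructor
  · rintro ⟨g, hg⟩
    refine ⟨g 0, ?_⟩
    have h := descProd_gauge (F := fun n => f (Fin.ofNat m n))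
      (F' := fun n => f' (Fin.ofNat m n)) (g := fun n => g (Fin.ofNat m n))
      (fun n => by simp only [Fin.ofNat_add_one, hg]) m
    have hm : Fin.ofNat m m = 0 := by ext; simp
    have h0 : Fin.ofNat m 0 = 0 := by ext; simp
    rw [h, hm, h0]
  · rintro ⟨c, hc⟩
    set P := descProd (fun n => f (Fin.ofNat m n)) with hP
    set P' := descProd (fun n => f' (Fin.ofNat m n)) with hP'
    refine ⟨fun i => P' i * c * (P i)⁻¹, fun i => ?_⟩
    have key : P' (i + 1 : Fin m) * c * (P (i + 1 : Fin m))⁻¹ =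
        P' (i + 1 : ℕ) * c * (P (i + 1 : ℕ))⁻¹ := by
      rcases Nat.lt_or_ge (i + 1 : ℕ) m with hi | hi
      · rw [Fin.val_add_one_of_lt' hi]
      · have him : (i + 1 : ℕ) = m := by omega
        have h0 : ((i + 1 : Fin m) : ℕ) = 0 := by simp [Fin.val_add, him]
        rw [h0, him, ← hc]
        simp [hP, hP', descProd]
    have hs : P (i + 1 : ℕ) = f i * P i := by simp [hP, descProd]
    have hs' : P' (i + 1 : ℕ) = f' i * P' i := by simp [hP', descProd]
    simp only [key, hs, hs']
    group

theorem prod_reverse_ofFn_mulSingle_zero {G : Type*} [Group G] {m : ℕ} [NeZero m] (x : G) :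
    (List.ofFn (Pi.mulSingle (0 : Fin m) x)).reverse.prod = x := by
  obtain ⟨n, rfl⟩ := Nat.exists_eq_succ_of_ne_zero (NeZero.ne m)
  simp [List.ofFn_succ, Fin.succ_ne_zero]

/-- For the long loop (cycle) quiver `C_m` with vertices `Fin m` and arrows
`a_i : i → i + 1` (mod `m`), two `G`-valued representations are gauge-equivalent iff their
holonomies `f(a_{m-1}) ⋯ f(a_0)` are conjugate in `G`; consequently the gauge orbit space
is in bijection with the set of conjugacy classes of `G`. -/
theorem stmt_2 {G : Type*} [Group G] (m : ℕ) [NeZero m] :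
    (∀ f f' : Fin m → G,
      gaugeRel (fun i : Fin m => i + 1) (fun i => i) f f' ↔
        IsConj ((List.ofFn f).reverse.prod) ((List.ofFn f').reverse.prod)) ∧
    ∃ Φ : Quotient (gaugeSetoid G (fun i : Fin m => i + 1) (fun i => i)) → ConjClasses G,
      (∀ f : Fin m → G,
        Φ (Quotient.mk (gaugeSetoid G (fun i : Fin m => i + 1) (fun i => i)) f) =
          ConjClasses.mk ((List.ofFn f).reverse.prod)) ∧
      Function.Bijective Φ := by
  refine ⟨gaugeRel_cycle_iff, Quotient.lift (fun f => ConjClasses.mk (List.ofFn f).reverse.prod)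
    (fun f f' h => ConjClasses.mk_eq_mk_iff_isConj.2 ((gaugeRel_cycle_iff f f').1 h)),
    fun _ => rfl, ?_, ?_⟩
  · rintro ⟨f⟩ ⟨f'⟩ h
    exact Quotient.sound ((gaugeRel_cycle_iff f f').2 (ConjClasses.mk_eq_mk_iff_isConj.1 h))
  · rintro ⟨x⟩
    exact ⟨Quotient.mk _ (Pi.mulSingle 0 x),
      congrArg ConjClasses.mk (prod_reverse_ofFn_mulSingle_zero x)⟩
end

section
/- Let Q be a quiver and n ≥ 1. Let f_1, f_2 : Q_A → Matrix(n,n,ℂ) be representations all of whose values lie in the unitary group U(n) (i.e., f_i(a)·f_i(a)ᴴ = 1 for every arrow a, where ᴴ denotes conjugate transpose). If f_1 and f_2 are gauge-equivalent over GL(n,ℂ), i.e., there exists g : Q_V → GL(n,ℂ) with f_2(a) = g(h(a)) · f_1(a) · g(t(a))⁻¹ for every arrow a, then f_1 and f_2 are gauge-equivalent over U(n): there exists k : Q_V → U(n) with f_2(a) = k(h(a)) · f_1(a) · k(t(a))⁻¹ for every arrow a. -/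
open Matrix
open scoped MatrixGroups

open scoped MatrixOrder ComplexOrder in
/-- Conjugation by a unitary matrix commutes with the positive square root. -/
lemma sqrt_conjTranspose_mul_mul_of_unitary {m : Type*} [Fintype m] [DecidableEq m]
    {M x : Matrix m m ℂ} (hM : M.PosSemidef) (hx : x * xᴴ = 1) :
    CFC.sqrt (xᴴ * M * x) = xᴴ * CFC.sqrt M * x := by
  refine CFC.sqrt_unique ?_ ((CFC.sqrt_nonneg M).posSemidef.conjTranspose_mul_mul_same x).nonneg
  calc xᴴ * CFC.sqrt M * x * (xᴴ * CFC.sqrt M * x)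
      = xᴴ * CFC.sqrt M * (x * xᴴ) * CFC.sqrt M * x := by simp only [Matrix.mul_assoc]
    _ = xᴴ * (CFC.sqrt M * CFC.sqrt M) * x := by rw [hx]; simp only [Matrix.mul_assoc, one_mul]
    _ = xᴴ * M * x := by rw [CFC.sqrt_mul_sqrt_self M hM.nonneg]

open scoped MatrixOrder ComplexOrder in
/-- The positive factor of the polar decomposition of an invertible matrix is invertible. -/
lemma isUnit_sqrt_conjTranspose_mul_self {m : Type*} [Fintype m] [DecidableEq m]
    (g : GL m ℂ) : IsUnit (CFC.sqrt ((g : Matrix m m ℂ)ᴴ * (g : Matrix m m ℂ))) := by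
  have hs := CFC.sqrt_mul_sqrt_self ((g : Matrix m m ℂ)ᴴ * (g : Matrix m m ℂ))
    (posSemidef_conjTranspose_mul_self _).nonneg
  refine isUnit_of_mul_isUnit_left (y := CFC.sqrt ((g : Matrix m m ℂ)ᴴ * (g : Matrix m m ℂ))) ?_
  rw [hs]
  exact (g.isUnit.star).mul g.isUnit

open scoped MatrixOrder ComplexOrder in
/-- The unitary factor `g (gᴴ g)^(-1/2)` in the polar decomposition of an invertible matrix. -/
noncomputable def polarFactor {m : Type*} [Fintype m] [DecidableEq m] (g : GL m ℂ) :
    Matrix m m ℂ :=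
  (g : Matrix m m ℂ) * (CFC.sqrt ((g : Matrix m m ℂ)ᴴ * (g : Matrix m m ℂ)))⁻¹

open scoped MatrixOrder ComplexOrder in
lemma polarFactor_mul_conjTranspose {m : Type*} [Fintype m] [DecidableEq m] (g : GL m ℂ) :
    polarFactor g * (polarFactor g)ᴴ = 1 := by
  have hu := (isUnit_iff_isUnit_det _).1 (isUnit_sqrt_conjTranspose_mul_self g)
  have hs := CFC.sqrt_mul_sqrt_self ((g : Matrix m m ℂ)ᴴ * (g : Matrix m m ℂ))
    (posSemidef_conjTranspose_mul_self _).nonneg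
  have hH : (CFC.sqrt ((g : Matrix m m ℂ)ᴴ * (g : Matrix m m ℂ)))ᴴ =
      CFC.sqrt ((g : Matrix m m ℂ)ᴴ * (g : Matrix m m ℂ)) :=
    (CFC.sqrt_nonneg ((g : Matrix m m ℂ)ᴴ * (g : Matrix m m ℂ))).posSemidef.isHermitian
  unfold polarFactor
  set P := CFC.sqrt ((g : Matrix m m ℂ)ᴴ * (g : Matrix m m ℂ))
  rw [mul_eq_one_comm, conjTranspose_mul, conjTranspose_nonsing_inv, hH]
  calc P⁻¹ * (g : Matrix m m ℂ)ᴴ * ((g : Matrix m m ℂ) * P⁻¹)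
      = P⁻¹ * ((g : Matrix m m ℂ)ᴴ * (g : Matrix m m ℂ)) * P⁻¹ := by simp only [Matrix.mul_assoc]
    _ = (P⁻¹ * P) * (P * P⁻¹) := by rw [← hs]; simp only [Matrix.mul_assoc]
    _ = 1 := by rw [nonsing_inv_mul _ hu, mul_nonsing_inv _ hu, one_mul]

open scoped MatrixOrder ComplexOrder in
/-- Unitary matrices intertwined by invertible matrices are intertwined by their polar factors. -/
lemma mul_polarFactor_eq {m : Type*} [Fintype m] [DecidableEq m] {x y : Matrix m m ℂ}
    (hx : x * xᴴ = 1) (hy : y * yᴴ = 1) {g t : GL m ℂ}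
    (h : y * (t : Matrix m m ℂ) = (g : Matrix m m ℂ) * x) :
    y * polarFactor t = polarFactor g * x := by
  have hP := (isUnit_iff_isUnit_det _).1 (isUnit_sqrt_conjTranspose_mul_self g)
  have hR := (isUnit_iff_isUnit_det _).1 (isUnit_sqrt_conjTranspose_mul_self t)
  unfold polarFactor
  generalize (g : Matrix m m ℂ) = G at *
  generalize (t : Matrix m m ℂ) = T at *
  have hTT : Tᴴ * T = xᴴ * (Gᴴ * G) * x := by
    calc Tᴴ * T = Tᴴ * (yᴴ * y) * T := by rw [mul_eq_one_comm.1 hy, Matrix.mul_one]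
      _ = (y * T)ᴴ * (y * T) := by simp only [conjTranspose_mul, Matrix.mul_assoc]
      _ = xᴴ * (Gᴴ * G) * x := by
        rw [h]; simp only [conjTranspose_mul, Matrix.mul_assoc]
  have hcomm : x * CFC.sqrt (Tᴴ * T) = CFC.sqrt (Gᴴ * G) * x := by
    rw [hTT, sqrt_conjTranspose_mul_mul_of_unitary (posSemidef_conjTranspose_mul_self G) hx,
      ← Matrix.mul_assoc, ← Matrix.mul_assoc, hx, Matrix.one_mul]
  calc y * (T * (CFC.sqrt (Tᴴ * T))⁻¹)
      = G * ((CFC.sqrt (Gᴴ * G))⁻¹ * (CFC.sqrt (Gᴴ * G) * x)) * (CFC.sqrt (Tᴴ * T))⁻¹ := by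
        rw [nonsing_inv_mul_cancel_left _ _ hP, ← Matrix.mul_assoc, h]
    _ = G * (CFC.sqrt (Gᴴ * G))⁻¹ * x * (CFC.sqrt (Tᴴ * T) * (CFC.sqrt (Tᴴ * T))⁻¹) := by
        rw [← hcomm]; simp only [Matrix.mul_assoc]
    _ = G * (CFC.sqrt (Gᴴ * G))⁻¹ * x := by rw [mul_nonsing_inv _ hR, Matrix.mul_one]

/-- If two unitary-valued quiver representations (`f_i(a)·f_i(a)ᴴ = 1` for all
arrows `a`) are gauge-equivalent over `GL(n, ℂ)`, then they are gauge-equivalent over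
`U(n)`. -/
theorem stmt_6 {V A : Type*} (hd tl : A → V) (n : ℕ) (hn : 1 ≤ n)
    (f₁ f₂ : A → Matrix (Fin n) (Fin n) ℂ)
    (h₁ : ∀ a, f₁ a * (f₁ a)ᴴ = 1) (h₂ : ∀ a, f₂ a * (f₂ a)ᴴ = 1)
    (g : V → GL (Fin n) ℂ)
    (hg : ∀ a, f₂ a = (g (hd a) : Matrix (Fin n) (Fin n) ℂ) * f₁ a *
      (((g (tl a))⁻¹ : GL (Fin n) ℂ) : Matrix (Fin n) (Fin n) ℂ)) :
    ∃ k : V → Matrix (Fin n) (Fin n) ℂ,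
      (∀ v, k v * (k v)ᴴ = 1) ∧
      ∀ a, f₂ a = k (hd a) * f₁ a * (k (tl a))⁻¹ := by
  refine ⟨fun v => polarFactor (g v), fun v => polarFactor_mul_conjTranspose (g v), fun a => ?_⟩
  have h : f₂ a * (g (tl a) : Matrix (Fin n) (Fin n) ℂ) = g (hd a) * f₁ a := by
    rw [hg a, Matrix.mul_assoc, Units.inv_mul, Matrix.mul_one]
  rw [← mul_polarFactor_eq (h₁ a) (h₂ a) h, Matrix.mul_assoc,
    inv_eq_right_inv (polarFactor_mul_conjTranspose _), polarFactor_mul_conjTranspose,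
    Matrix.mul_one]
end

section
/- Let Q be a finite quiver and n ≥ 1. There exists a continuous map Φ : [0,1] × (GL(n,ℂ))^{Q_A} → (GL(n,ℂ))^{Q_A} which is a strong deformation retraction of the space of GL(n,ℂ)-valued representations of Q onto the subspace of U(n)-valued representations (those f with f(a) ∈ U(n) for every arrow a), and which is equivariant for the gauge action of U(n)^{Q_V}: for every t ∈ [0,1], every representation f, and every γ : Q_V → U(n), one has Φ(t, γ·f) = γ·Φ(t, f), where (γ·f)(a) = γ(h(a))·f(a)·γ(t(a))⁻¹. -/
open Matrix
open scoped MatrixGroups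

section PolarRetraction

variable {A : Type*} [CStarAlgebra A] [PartialOrder A] [StarOrderedRing A]

lemma Units.isStrictlyPositive_cfcAbs (u : Aˣ) : IsStrictlyPositive (CFC.abs (u : A)) :=
  IsStrictlyPositive.sqrt _ <|
    (u.isUnit.star.mul u.isUnit).isStrictlyPositive (star_mul_self_nonneg (u : A))

/-- The absolute value of a unit of a C⋆-algebra, as a unit. -/
noncomputable def Units.cfcAbs (u : Aˣ) : Aˣ := u.isStrictlyPositive_cfcAbs.isUnit.unit

@[simp]
lemma Units.val_cfcAbs (u : Aˣ) : (u.cfcAbs : A) = CFC.abs (u : A) := rfl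

lemma Units.continuous_cfcAbs : Continuous (Units.cfcAbs : Aˣ → Aˣ) := by
  rw [Units.isOpenEmbedding_val.isEmbedding.continuous_iff]
  exact CFC.continuous_abs.comp Units.continuous_val

/-- Multiplying by unitaries `v` on the left and `w⁻¹` on the right conjugates the absolute value
by `w`. -/
lemma Units.cfcAbs_mul_mul_inv {v w : Aˣ} (hv : star (v : A) * v = 1) (hw : star (w : A) * w = 1)
    (u : Aˣ) : (v * u * w⁻¹).cfcAbs = w * u.cfcAbs * w⁻¹ := by
  have hw' : star (w : A) = ↑w⁻¹ := (Units.inv_eq_of_mul_eq_one_left hw).symm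
  have hw'' : star (↑w⁻¹ : A) = w := by rw [← hw', star_star]
  ext
  simp only [Units.val_cfcAbs, Units.val_mul, CFC.abs]
  refine CFC.sqrt_unique ?_ ?_
  · have : CFC.sqrt (star (u : A) * u) * CFC.sqrt (star (u : A) * u) = star (u : A) * u :=
      CFC.abs_mul_abs (u : A)
    calc _ = (w : A) * (CFC.sqrt (star (u : A) * u) * CFC.sqrt (star (u : A) * u)) * ↑w⁻¹ := by
          simp [mul_assoc]
      _ = w * (star (u : A) * (star (v : A) * v) * u) * ↑w⁻¹ := by rw [this, hv, mul_one]
      _ = _ := by simp only [star_mul, hw'', mul_assoc]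
  · rw [← hw']
    exact star_right_conjugate_nonneg (CFC.sqrt_nonneg _) _

lemma Units.isUnit_lineMap_one_inv_cfcAbs (t : unitInterval) (u : Aˣ) :
    IsUnit ((1 - t : ℝ) • (1 : A) + (t : ℝ) • (↑(u.cfcAbs⁻¹) : A)) := by
  rcases t.2.1.eq_or_lt with ht | ht
  · simp [← ht]
  · have h : IsStrictlyPositive (↑(u.cfcAbs⁻¹) : A) := by
      rw [← Ring.inverse_unit]
      exact u.isStrictlyPositive_cfcAbs.ringInverse
    exact (IsStrictlyPositive.nonneg_add (smul_nonneg (sub_nonneg.2 t.2.2) zero_le_one)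
      (h.smul ht)).isUnit

/-- The path `t ↦ u * ((1 - t) + t * |u|⁻¹)` of units of a C⋆-algebra, from `u` to the unitary part
`u * |u|⁻¹` of its polar decomposition. -/
noncomputable def Units.polarPath (t : unitInterval) (u : Aˣ) : Aˣ :=
  u * (u.isUnit_lineMap_one_inv_cfcAbs t).unit

lemma Units.val_polarPath (t : unitInterval) (u : Aˣ) :
    (u.polarPath t : A) =
      u * ((1 - t : ℝ) • (1 : A) + (t : ℝ) • (↑(u.cfcAbs⁻¹) : A)) := rfl

lemma Units.continuous_polarPath :
    Continuous fun p : unitInterval × Aˣ ↦ p.2.polarPath p.1 := by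
  rw [Units.isOpenEmbedding_val.isEmbedding.continuous_iff]
  have h : Continuous fun p : unitInterval × Aˣ ↦ (↑(p.2.cfcAbs⁻¹) : A) :=
    Units.continuous_val.comp (Units.continuous_cfcAbs.comp continuous_snd).inv
  have h' : Continuous fun p : unitInterval × Aˣ ↦ (p.2 : A) :=
    Units.continuous_val.comp continuous_snd
  simp only [Function.comp_def, Units.val_polarPath]
  fun_prop

lemma Units.polarPath_zero (u : Aˣ) : u.polarPath 0 = u := by
  ext
  simp [Units.val_polarPath]

lemma Units.polarPath_of_star_mul_self {u : Aˣ} (hu : star (u : A) * u = 1) (t : unitInterval) :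
    u.polarPath t = u := by
  have h : u.cfcAbs = 1 := by
    ext
    simp [CFC.abs, hu]
  ext
  simp [Units.val_polarPath, h, ← add_smul]

lemma Units.star_polarPath_one_mul_self (u : Aˣ) :
    star (u.polarPath 1 : A) * (u.polarPath 1 : A) = 1 := by
  have h : star (↑(u.cfcAbs⁻¹) : A) = ↑(u.cfcAbs⁻¹) := by
    rw [← Units.coe_star_inv]
    congr 2
    ext
    exact (CFC.abs_nonneg (u : A)).isSelfAdjoint.star_eq
  have h' : (u.cfcAbs : A) * u.cfcAbs = star (u : A) * u := CFC.abs_mul_abs (u : A)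
  calc _ = (↑(u.cfcAbs⁻¹) : A) * (star (u : A) * u) * ↑(u.cfcAbs⁻¹) := by
        simp [Units.val_polarPath, h, mul_assoc]
    _ = 1 := by rw [← h', ← mul_assoc, Units.inv_mul, one_mul, Units.mul_inv]

lemma Units.polarPath_mul_mul_inv {v w : Aˣ} (hv : star (v : A) * v = 1)
    (hw : star (w : A) * w = 1) (t : unitInterval) (u : Aˣ) :
    (v * u * w⁻¹).polarPath t = v * u.polarPath t * w⁻¹ := by
  ext
  rw [Units.val_polarPath, Units.cfcAbs_mul_mul_inv hv hw]
  simp [Units.val_polarPath, mul_add, add_mul, mul_assoc]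

end PolarRetraction

/-- For a finite quiver `Q`, there is a continuous strong deformation
retraction `Φ` of the space `(GL(n,ℂ))^{Q_A}` of `GL(n,ℂ)`-valued representations of `Q`
onto the subspace of `U(n)`-valued representations, which is equivariant for the gauge
action of `U(n)^{Q_V}`. -/
theorem stmt_9 {V A : Type*} [Fintype V] [Fintype A] (hd tl : A → V) (n : ℕ) (hn : 1 ≤ n) :
    ∃ Φ : ℝ × (A → GL (Fin n) ℂ) → (A → GL (Fin n) ℂ),
      ContinuousOn Φ (Set.Icc (0 : ℝ) 1 ×ˢ (Set.univ : Set (A → GL (Fin n) ℂ))) ∧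
      (∀ f : A → GL (Fin n) ℂ, Φ (0, f) = f) ∧
      (∀ t ∈ Set.Icc (0 : ℝ) 1, ∀ f : A → GL (Fin n) ℂ,
        (∀ a, (f a : Matrix (Fin n) (Fin n) ℂ) * (f a : Matrix (Fin n) (Fin n) ℂ)ᴴ = 1) →
          Φ (t, f) = f) ∧
      (∀ f : A → GL (Fin n) ℂ, ∀ a,
        (Φ (1, f) a : Matrix (Fin n) (Fin n) ℂ) * (Φ (1, f) a : Matrix (Fin n) (Fin n) ℂ)ᴴ
          = 1) ∧
      (∀ t ∈ Set.Icc (0 : ℝ) 1, ∀ f : A → GL (Fin n) ℂ, ∀ γ : V → GL (Fin n) ℂ,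
        (∀ v, (γ v : Matrix (Fin n) (Fin n) ℂ) * (γ v : Matrix (Fin n) (Fin n) ℂ)ᴴ = 1) →
          Φ (t, fun a => γ (hd a) * f a * (γ (tl a))⁻¹) =
            fun a => γ (hd a) * Φ (t, f) a * (γ (tl a))⁻¹) := by
  open scoped MatrixOrder Matrix.Norms.L2Operator in
  refine ⟨fun p a ↦ (p.2 a).polarPath (Set.projIcc 0 1 zero_le_one p.1), ?_, ?_, ?_, ?_, ?_⟩
  · refine Continuous.continuousOn (continuous_pi fun a ↦ ?_)
    exact Units.continuous_polarPath.comp (((continuous_projIcc (h := zero_le_one)).comp continuous_fst).prodMk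
      ((continuous_apply a).comp continuous_snd))
  · intro f
    funext a
    simpa using Units.polarPath_zero (f a)
  · intro t _ f hf
    funext a
    exact Units.polarPath_of_star_mul_self (mul_eq_one_comm.1 (hf a)) _
  · intro f a
    simpa [star_eq_conjTranspose] using
      mul_eq_one_comm.1 (Units.star_polarPath_one_mul_self (f a))
  · intro t _ f γ hγ
    funext a
    exact Units.polarPath_mul_mul_inv (mul_eq_one_comm.1 (hγ _)) (mul_eq_one_comm.1 (hγ _)) _ _
end

section
/- Let Q be a finite quiver that is strongly connected (super-cyclic): for every ordered pair of vertices there is a directed path, following the arrows, from the first vertex to the second; in particular every arrow lies on an oriented cycle. Let n ≥ 1 and let f : Q_A → GL(n,ℂ) be a GL(n,ℂ)-valued representation of Q. If the orbit of f under the gauge action of (GL(n,ℂ))^{Q_V} is closed in the space (GL(n,ℂ))^{Q_A} of invertible representations, then the orbit of the corresponding tuple of matrices x = f (each x(a) viewed as an element of Matrix(n,n,ℂ)) under the same gauge action is closed in the space of all additive representations Q_A → Matrix(n,n,ℂ) with the product topology. -/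
open Matrix
open scoped MatrixGroups

/-- The orbit of an additive quiver representation `x : Q_A → Matrix(n,n,ℂ)` under the
gauge action of `∏_{v ∈ Q_V} GL(n,ℂ)`, `(g·x)(a) = g(h(a))·x(a)·g(t(a))⁻¹`. -/
def glGaugeOrbit {V A : Type*} (hd tl : A → V) (n : ℕ)
    (x : A → Matrix (Fin n) (Fin n) ℂ) : Set (A → Matrix (Fin n) (Fin n) ℂ) :=
  {y | ∃ g : V → GL (Fin n) ℂ, ∀ a,
    y a = (g (hd a) : Matrix (Fin n) (Fin n) ℂ) * x a *
      (((g (tl a))⁻¹ : GL (Fin n) ℂ) : Matrix (Fin n) (Fin n) ℂ)}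

/-- Along a path from `v` to `w`, the gauge factors of the product of the arrow weights telescope. -/
lemma exists_list_prod_gauge_eq {V A K : Type*} [Field K] (hd tl : A → V) {v w : V}
    (h : Relation.ReflTransGen (fun p q => ∃ a, tl a = p ∧ hd a = q) v w) :
    ∃ l : List A, ∀ (c : V → Kˣ) (d : A → K),
      (l.map fun a => c (hd a) * d a * ((c (tl a))⁻¹ : Kˣ)).prod =
        c w * (l.map d).prod * ((c v)⁻¹ : Kˣ) := by
  induction h with
  | refl => exact ⟨[], fun c d => by simp⟩
  | tail _ hab ih =>
    obtain ⟨l, hl⟩ := ih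
    obtain ⟨a, rfl, rfl⟩ := hab
    refine ⟨a :: l, fun c d => ?_⟩
    rw [List.map_cons, List.prod_cons, hl, List.map_cons, List.prod_cons]
    linear_combination
      (c (hd a) * d a * (l.map d).prod * ((c v)⁻¹ : Kˣ) : K) * (c (tl a)).inv_mul

/-- Determinants on the gauge orbit of `x` are scalar gauge transforms of those of `x`. -/
lemma exists_det_eq_of_mem_glGaugeOrbit {V A : Type*} {hd tl : A → V} {n : ℕ}
    {x y : A → Matrix (Fin n) (Fin n) ℂ} (hy : y ∈ glGaugeOrbit hd tl n x) :
    ∃ c : V → ℂˣ, ∀ a, (y a).det = c (hd a) * (x a).det * ((c (tl a))⁻¹ : ℂˣ) := by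
  obtain ⟨g, hg⟩ := hy
  refine ⟨fun v => Matrix.GeneralLinearGroup.det (g v), fun a => ?_⟩
  rw [hg a, Matrix.det_mul, Matrix.det_mul, ← map_inv]
  rfl

/-- The orbit of an invertible representation consists of invertible representations. -/
lemma isUnit_of_mem_glGaugeOrbit {V A : Type*} {hd tl : A → V} {n : ℕ}
    {x y : A → Matrix (Fin n) (Fin n) ℂ} (hx : ∀ a, IsUnit (x a))
    (hy : y ∈ glGaugeOrbit hd tl n x) (a : A) : IsUnit (y a) := by
  obtain ⟨g, hg⟩ := hy
  rw [hg a]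
  exact ((g (hd a)).isUnit.mul (hx a)).mul (g (tl a))⁻¹.isUnit

/-- If the quiver is strongly connected, every limit of points in the orbit of an invertible
representation is invertible: determinants along oriented cycles are continuous invariants. -/
lemma isUnit_of_mem_closure_glGaugeOrbit {V A : Type*} {hd tl : A → V}
    (hsc : ∀ v w : V, Relation.ReflTransGen (fun p q => ∃ a, tl a = p ∧ hd a = q) v w)
    {n : ℕ} {x y : A → Matrix (Fin n) (Fin n) ℂ} (hx : ∀ a, IsUnit (x a))
    (hy : y ∈ closure (glGaugeOrbit hd tl n x)) (a : A) : IsUnit (y a) := by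
  obtain ⟨l, hl⟩ := exists_list_prod_gauge_eq (K := ℂ) hd tl (hsc (hd a) (tl a))
  have hinv : ∀ z ∈ glGaugeOrbit hd tl n x,
      (z a).det * (l.map fun b => (z b).det).prod =
        (x a).det * (l.map fun b => (x b).det).prod := by
    intro z hz
    obtain ⟨c, hc⟩ := exists_det_eq_of_mem_glGaugeOrbit hz
    simp only [hc]
    rw [hl c fun b => (x b).det]
    have h₁ := (c (hd a)).mul_inv
    have h₂ := (c (tl a)).mul_inv
    generalize (l.map fun b => (x b).det).prod = P
    linear_combination (x a).det * P * (c (tl a) * ((c (tl a))⁻¹ : ℂˣ) : ℂ) * h₁ +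
      (x a).det * P * h₂
  have hdet (b : A) : Continuous fun z : A → Matrix (Fin n) (Fin n) ℂ => (z b).det :=
    (continuous_apply b).matrix_det
  have hclosed : IsClosed {z : A → Matrix (Fin n) (Fin n) ℂ |
      (z a).det * (l.map fun b => (z b).det).prod =
        (x a).det * (l.map fun b => (x b).det).prod} :=
    isClosed_eq ((hdet a).mul (continuous_list_prod l fun b _ => hdet b)) continuous_const
  have hya : (y a).det * (l.map fun b => (y b).det).prod =
      (x a).det * (l.map fun b => (x b).det).prod := closure_minimal hinv hclosed hy
  have hne (b : A) : (x b).det ≠ 0 := ((Matrix.isUnit_iff_isUnit_det _).1 (hx b)).ne_zero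
  have hprod : (x a).det * (l.map fun b => (x b).det).prod ≠ 0 :=
    mul_ne_zero (hne a) (List.prod_ne_zero (by simpa using fun b _ => hne b))
  rw [← hya] at hprod
  exact (Matrix.isUnit_iff_isUnit_det _).2 (isUnit_iff_ne_zero.2 (left_ne_zero_of_mul hprod))

/-- For a finite strongly connected (super-cyclic) quiver `Q`, if the gauge
orbit of an invertible representation `x` is closed in the subspace of invertible
representations, then it is closed in the space of all additive representations
`Q_A → Matrix(n,n,ℂ)` with the product topology. -/
theorem stmt_10 {V A : Type*} [Fintype V] [Fintype A] (hd tl : A → V)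
    (hsc : ∀ v w : V, Relation.ReflTransGen (fun p q => ∃ a, tl a = p ∧ hd a = q) v w)
    (n : ℕ) (hn : 1 ≤ n)
    (x : A → Matrix (Fin n) (Fin n) ℂ) (hx : ∀ a, IsUnit (x a))
    (horb : IsClosed {y : {y : A → Matrix (Fin n) (Fin n) ℂ // ∀ a, IsUnit (y a)} |
      (y : A → Matrix (Fin n) (Fin n) ℂ) ∈ glGaugeOrbit hd tl n x}) :
    IsClosed (glGaugeOrbit hd tl n x) := by
  obtain ⟨t, ht, hts⟩ := isClosed_induced_iff.1 horb
  have hsub : glGaugeOrbit hd tl n x ⊆ t := fun y hy =>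
    (Set.ext_iff.1 hts ⟨y, isUnit_of_mem_glGaugeOrbit hx hy⟩).2 hy
  refine isClosed_of_closure_subset fun y hy => ?_
  exact (Set.ext_iff.1 hts ⟨y, isUnit_of_mem_closure_glGaugeOrbit hsc hx hy⟩).1
    (closure_minimal hsub ht hy)
end

section
/- Let Q be a finite quiver, n a natural number, and v a vertex of Q that is a sink (no arrow of Q has tail v) or a source (no arrow of Q has head v). Let x : Q_A → Matrix(n,n,ℂ) be an additive representation such that x(a) ≠ 0 for some arrow a incident to v (with head v in the sink case, tail v in the source case). Then the orbit of x under the gauge action of ∏_{v∈Q_V} GL(n,ℂ) is not closed in the space of additive representations Q_A → Matrix(n,n,ℂ) with the product topology. -/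
open Matrix
open scoped MatrixGroups

/-- The representation obtained from `x` by scaling the arrows incident to `v` by `c`. -/
noncomputable def scaleAt {V A : Type*} (hd tl : A → V) (n : ℕ) (v : V)
    (x : A → Matrix (Fin n) (Fin n) ℂ) (c : ℂ) : A → Matrix (Fin n) (Fin n) ℂ :=
  open Classical in fun a => if hd a = v ∨ tl a = v then c • x a else x a

theorem continuous_scaleAt {V A : Type*} (hd tl : A → V) (n : ℕ) (v : V)
    (x : A → Matrix (Fin n) (Fin n) ℂ) : Continuous (scaleAt hd tl n v x) := by
  refine continuous_pi fun a => ?_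
  by_cases h : hd a = v ∨ tl a = v
  · simp only [scaleAt, if_pos h]
    fun_prop
  · simpa only [scaleAt, if_neg h] using continuous_const

/-- Scalar matrices concentrated at an end `v` scale exactly the arrows incident to `v`. -/
theorem scaleAt_mem_glGaugeOrbit {V A : Type*} (hd tl : A → V) (n : ℕ) (v : V)
    (x : A → Matrix (Fin n) (Fin n) ℂ) (hv : (∀ a, tl a ≠ v) ∨ ∀ a, hd a ≠ v)
    {c : ℂ} (hc : c ≠ 0) : scaleAt hd tl n v x c ∈ glGaugeOrbit hd tl n x := by
  classical
  let s : GL (Fin n) ℂ :=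
    ⟨c • 1, c⁻¹ • 1, by simp [smul_smul, hc], by simp [smul_smul, hc]⟩
  have hs : (s : Matrix (Fin n) (Fin n) ℂ) = c • 1 := rfl
  rcases hv with hv | hv
  · refine ⟨fun w => if w = v then s else 1, fun a => ?_⟩
    by_cases h : hd a = v <;> simp [scaleAt, h, hv a, hs]
  · refine ⟨fun w => if w = v then s⁻¹ else 1, fun a => ?_⟩
    by_cases h : tl a = v <;> simp only [scaleAt, h, hv a, if_true, if_false, or_true, or_false,
      inv_inv, inv_one, Units.val_one, one_mul, mul_one, hs, mul_smul_comm]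

theorem glGaugeOrbit_eq_zero {V A : Type*} (hd tl : A → V) (n : ℕ)
    {x y : A → Matrix (Fin n) (Fin n) ℂ} (hy : y ∈ glGaugeOrbit hd tl n x) {a : A}
    (ha : y a = 0) : x a = 0 := by
  obtain ⟨g, hg⟩ := hy
  have h := hg a
  rw [ha] at h
  have h' := (Units.mul_left_eq_zero _).mp h.symm
  exact (Units.mul_right_eq_zero _).mp h'

/-- If `v` is a sink (no arrow has tail `v`) or a source (no arrow has head
`v`) of a finite quiver and the additive representation `x` is nonzero on some arrow
incident to `v` (with head `v` in the sink case, tail `v` in the source case), then the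
gauge orbit of `x` is not closed in the space of additive representations. -/
theorem stmt_11 {V A : Type*} [Fintype V] [Fintype A] (hd tl : A → V) (n : ℕ)
    (v : V) (x : A → Matrix (Fin n) (Fin n) ℂ)
    (hend : ((∀ a, tl a ≠ v) ∧ ∃ a, hd a = v ∧ x a ≠ 0) ∨
            ((∀ a, hd a ≠ v) ∧ ∃ a, tl a = v ∧ x a ≠ 0)) :
    ¬ IsClosed (glGaugeOrbit hd tl n x) := by
  intro hcl
  have hv : (∀ a, tl a ≠ v) ∨ ∀ a, hd a ≠ v := hend.imp And.left And.left
  obtain ⟨a, ha, hxa⟩ : ∃ a, (hd a = v ∨ tl a = v) ∧ x a ≠ 0 := by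
    rcases hend with ⟨-, a, h, hxa⟩ | ⟨-, a, h, hxa⟩
    · exact ⟨a, Or.inl h, hxa⟩
    · exact ⟨a, Or.inr h, hxa⟩
  have hlim : Filter.Tendsto (scaleAt hd tl n v x) (nhdsWithin 0 {0}ᶜ)
      (nhds (scaleAt hd tl n v x 0)) :=
    ((continuous_scaleAt hd tl n v x).tendsto 0).mono_left nhdsWithin_le_nhds
  have hmem : scaleAt hd tl n v x 0 ∈ glGaugeOrbit hd tl n x :=
    hcl.mem_of_tendsto hlim <| Filter.mem_of_superset self_mem_nhdsWithin
      fun _ hc => scaleAt_mem_glGaugeOrbit hd tl n v x hv hc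
  exact hxa <| glGaugeOrbit_eq_zero hd tl n hmem (by simp [scaleAt, ha])
end

section
/- Let Q be a finite quiver having at least one end: there is a vertex v incident to at least one arrow such that v is a sink (no arrow has tail v) or a source (no arrow has head v). Let n ≥ 1. Then the set of additive representations x : Q_A → Matrix(n,n,ℂ) whose orbit under the gauge action of ∏_{v∈Q_V} GL(n,ℂ) is closed is not dense in the space of all additive representations with the product topology. (Since closed orbits are exactly the semisimple representations, in a quiver with ends the semisimple additive representations do not form a dense set.) -/
open Matrix
open scoped MatrixGroups

/-- If the orbit of `x` is closed and contains every rescaling of `x` on the arrows in `P` by a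
nonzero scalar, then `x` vanishes on `P`. -/
lemma eq_zero_of_isClosed_glGaugeOrbit {V A : Type*} {hd tl : A → V} {n : ℕ}
    {x : A → Matrix (Fin n) (Fin n) ℂ} (hx : IsClosed (glGaugeOrbit hd tl n x))
    (P : A → Prop) [DecidablePred P]
    (hP : ∀ c : ℂ, c ≠ 0 → (fun a => if P a then c • x a else x a) ∈ glGaugeOrbit hd tl n x)
    {a : A} (ha : P a) : x a = 0 := by
  have hcont : Continuous fun c : ℂ => fun a => if P a then c • x a else x a := by
    refine continuous_pi fun b => ?_
    by_cases hb : P b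
    · simp only [hb, if_true]
      fun_prop
    · simpa only [hb, if_false] using continuous_const
  have hlim := (hcont.tendsto 0).mono_left (nhdsWithin_le_nhds (s := {0}ᶜ))
  obtain ⟨g, hg⟩ := hx.mem_of_tendsto hlim
    (by filter_upwards [self_mem_nhdsWithin] with c hc using hP c hc)
  have h0 := hg a
  simp only [ha, if_true, zero_smul] at h0
  have h1 := Units.mul_left_eq_zero ((g (tl a))⁻¹) |>.mp h0.symm
  exact Units.mul_right_eq_zero (g (hd a)) |>.mp h1

/-- Acting by the scalar `c` at a sink rescales the incoming arrows by `c`. -/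
lemma smul_mem_glGaugeOrbit_of_sink {V A : Type*} [DecidableEq V] {hd tl : A → V} {n : ℕ} {v : V}
    (hv : ∀ a, tl a ≠ v) (x : A → Matrix (Fin n) (Fin n) ℂ) {c : ℂ} (hc : c ≠ 0) :
    (fun a => if hd a = v then c • x a else x a) ∈ glGaugeOrbit hd tl n x := by
  refine ⟨Function.update 1 v (Units.map (algebraMap ℂ (Matrix (Fin n) (Fin n) ℂ)).toMonoidHom
    (Units.mk0 c hc)), fun a => ?_⟩
  by_cases h : hd a = v
  · simp [h, hv a, Algebra.smul_def]
  · simp [h, hv a]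

/-- Acting by the scalar `c⁻¹` at a source rescales the outgoing arrows by `c`. -/
lemma smul_mem_glGaugeOrbit_of_source {V A : Type*} [DecidableEq V] {hd tl : A → V} {n : ℕ}
    {v : V} (hv : ∀ a, hd a ≠ v) (x : A → Matrix (Fin n) (Fin n) ℂ) {c : ℂ} (hc : c ≠ 0) :
    (fun a => if tl a = v then c • x a else x a) ∈ glGaugeOrbit hd tl n x := by
  refine ⟨Function.update 1 v (Units.map (algebraMap ℂ (Matrix (Fin n) (Fin n) ℂ)).toMonoidHom
    (Units.mk0 c hc))⁻¹, fun a => ?_⟩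
  by_cases h : tl a = v
  · simp only [h, hv a, if_true, ne_eq, not_false_eq_true, Function.update_of_ne,
      Function.update_self, inv_inv, Pi.one_apply, Units.val_one, one_mul]
    exact (Algebra.smul_def c (x a)).trans (Algebra.commutes c (x a))
  · simp [h, hv a]

/-- A set of representations that all vanish on one arrow is not dense. -/
lemma not_dense_of_forall_apply_eq_zero {A : Type*} {n : ℕ} (hn : 1 ≤ n)
    {s : Set (A → Matrix (Fin n) (Fin n) ℂ)} {a : A} (hs : ∀ x ∈ s, x a = 0) : ¬ Dense s := by
  intro h
  have : Nonempty (Fin n) := ⟨⟨0, hn⟩⟩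
  have hcl : IsClosed {x : A → Matrix (Fin n) (Fin n) ℂ | x a = 0} :=
    isClosed_eq (continuous_apply a) continuous_const
  have h1 : (1 : A → Matrix (Fin n) (Fin n) ℂ) ∈ {x : A → Matrix (Fin n) (Fin n) ℂ | x a = 0} :=
    hcl.closure_subset_iff.mpr hs (h 1)
  exact one_ne_zero (show (1 : Matrix (Fin n) (Fin n) ℂ) = 0 from h1)

/-- If a finite quiver has an end (a vertex incident to at least one arrow
which is a sink or a source), then the set of additive representations with closed gauge
orbit (the semisimple representations) is not dense in the space of all additive
representations with the product topology. -/
theorem stmt_13 {V A : Type*} [Fintype V] [Fintype A] (hd tl : A → V) (n : ℕ) (hn : 1 ≤ n)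
    (hend : ∃ v : V, (∃ a, hd a = v ∨ tl a = v) ∧
      ((∀ a, tl a ≠ v) ∨ (∀ a, hd a ≠ v))) :
    ¬ Dense {x : A → Matrix (Fin n) (Fin n) ℂ | IsClosed (glGaugeOrbit hd tl n x)} := by
  classical
  obtain ⟨v, ⟨a, ha⟩, hv | hv⟩ := hend
  · exact not_dense_of_forall_apply_eq_zero hn fun x hx =>
      eq_zero_of_isClosed_glGaugeOrbit hx (fun a => hd a = v)
        (fun c hc => smul_mem_glGaugeOrbit_of_sink hv x hc) (ha.resolve_right (hv a))
  · exact not_dense_of_forall_apply_eq_zero hn fun x hx =>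
      eq_zero_of_isClosed_glGaugeOrbit hx (fun a => tl a = v)
        (fun c hc => smul_mem_glGaugeOrbit_of_source hv x hc) (ha.resolve_left (hv a))
end

section
/- Let Q be a finite connected quiver that is super-cyclic (strongly connected: for every ordered pair of vertices there is a directed path, following the arrows, from the first to the second; in particular every arrow lies on an oriented cycle), and let n ≥ 1. Let x, x' : Q_A → Matrix(n,n,ℂ) be unimodular representations, i.e., det x(a) = 1 and det x'(a) = 1 for every arrow a. If x and x' lie in the same orbit of the gauge action of ∏_{v∈Q_V} GL(n,ℂ), i.e., there exists g : Q_V → GL(n,ℂ) with x'(a) = g(h(a))·x(a)·g(t(a))⁻¹ for all a, then they lie in the same orbit of the gauge action of ∏_{v∈Q_V} SL(n,ℂ): there exists s : Q_V → GL(n,ℂ) with det s(v) = 1 for every vertex v and x'(a) = s(h(a))·x(a)·s(t(a))⁻¹ for all a. -/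
open Matrix
open scoped MatrixGroups

/-- For a finite connected super-cyclic (strongly connected) quiver, two
unimodular representations (`det x(a) = 1` for all arrows) lying in the same
`∏_v GL(n,ℂ)` gauge orbit lie in the same `∏_v SL(n,ℂ)` gauge orbit. -/
theorem stmt_14 {V A : Type*} [Fintype V] [Fintype A] (hd tl : A → V)
    (hsc : ∀ v w : V, Relation.ReflTransGen (fun p q => ∃ a, tl a = p ∧ hd a = q) v w)
    (n : ℕ) (hn : 1 ≤ n)
    (x x' : A → Matrix (Fin n) (Fin n) ℂ)
    (hx : ∀ a, (x a).det = 1) (hx' : ∀ a, (x' a).det = 1)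
    (g : V → GL (Fin n) ℂ)
    (hg : ∀ a, x' a = (g (hd a) : Matrix (Fin n) (Fin n) ℂ) * x a *
      (((g (tl a))⁻¹ : GL (Fin n) ℂ) : Matrix (Fin n) (Fin n) ℂ)) :
    ∃ s : V → GL (Fin n) ℂ,
      (∀ v, ((s v : Matrix (Fin n) (Fin n) ℂ)).det = 1) ∧
      ∀ a, x' a = (s (hd a) : Matrix (Fin n) (Fin n) ℂ) * x a *
        (((s (tl a))⁻¹ : GL (Fin n) ℂ) : Matrix (Fin n) (Fin n) ℂ) := by
  have det_tl_eq_hd (a : A) : (g (tl a)).det = (g (hd a)).det := by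
    have h := congrArg Matrix.det (hg a)
    rw [det_mul, det_mul, hx, hx', mul_one, ← GeneralLinearGroup.val_det_apply,
      ← GeneralLinearGroup.val_det_apply, map_inv, ← Units.val_mul] at h
    exact (mul_inv_eq_one.mp (Units.ext h.symm)).symm
  have det_eq (v w : V) : (g v).det = (g w).det := by
    induction hsc v w with
    | refl => rfl
    | tail _ h ih =>
      obtain ⟨a, rfl, rfl⟩ := h
      exact ih.trans (det_tl_eq_hd a)
  obtain hV | ⟨⟨v₀⟩⟩ := isEmpty_or_nonempty V
  · exact ⟨g, fun v => isEmptyElim v, hg⟩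
  have hn₀ : n ≠ 0 := by omega
  obtain ⟨c, hc⟩ := IsAlgClosed.exists_pow_nat_eq
    (((g v₀).det⁻¹ : ℂˣ) : ℂ) (Nat.pos_of_ne_zero hn₀)
  have hc₀ : c ≠ 0 := by
    rintro rfl
    rw [zero_pow hn₀] at hc
    exact Units.ne_zero _ hc.symm
  refine ⟨fun v => Units.mk0 c hc₀ • g v, fun v => ?_, fun a => ?_⟩
  · rw [Units.val_smul, Units.smul_mk0, det_smul, Fintype.card_fin, hc,
      ← GeneralLinearGroup.val_det_apply, det_eq v v₀, Units.inv_mul]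
  · have inv_smul_eq : (Units.mk0 c hc₀ • g (tl a))⁻¹ = (Units.mk0 c hc₀)⁻¹ • (g (tl a))⁻¹ := by
      refine inv_eq_of_mul_eq_one_right (Units.ext ?_)
      rw [Units.val_mul, Units.val_smul, Units.val_smul, smul_mul_assoc, mul_smul_comm,
        smul_inv_smul, Units.mul_inv, Units.val_one]
    rw [hg a, inv_smul_eq, Units.val_smul, Units.val_smul, smul_mul_assoc, smul_mul_assoc,
      mul_smul_comm, smul_inv_smul]
end
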